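/- arXiv:2502.03701 — 2 statements merged into one kernel-verified Lean document; each statement's English description precedes it below -/
import Mathlib

section
/- (Per-iteration descent, negative curvature case.) Let f : ℝ^d → ℝ be twice continuously differentiable and satisfy Hessian directional smoothness with constant L₂ > 0, let ρ ∈ (0, 1) and 0 < s_NC_min ≤ s_NC_max. Fix x with g(x) ≠ 0, suppose ⟨g(x), H(x) g(x)⟩ < 0, and let p = −s g(x) with s_NC_min ≤ s ≤ s_NC_max. Then the step size α = √(6(1 − ρ)/(L₂ s_NC_max ‖p‖)) satisfies the Armijo condition and yields f(x + α p) ≤ f(x) − ρ √(6(1 − ρ) s_NC_min/(L₂ s_NC_max)) · ‖g(x)‖^{3/2}. -/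
open scoped RealInnerProductSpace

/-- The Hessian of `f` at `x`, as a continuous linear map. -/
noncomputable def hessian {d : ℕ} (f : EuclideanSpace ℝ (Fin d) → ℝ)
    (x : EuclideanSpace ℝ (Fin d)) :
    EuclideanSpace ℝ (Fin d) →L[ℝ] EuclideanSpace ℝ (Fin d) :=
  fderiv ℝ (gradient f) x

/-- Cubic upper bound for a function on the half-line whose second derivative grows at most
linearly. -/
theorem le_cubic_of_second_deriv_le {φ φ' φ'' : ℝ → ℝ} {c : ℝ}
    (h₁ : ∀ t, HasDerivAt φ (φ' t) t) (h₂ : ∀ t, HasDerivAt φ' (φ'' t) t)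
    (hbound : ∀ t, 0 ≤ t → φ'' t ≤ c * t) {t : ℝ} (ht : 0 ≤ t) :
    φ t ≤ φ 0 + φ' 0 * t + c * t ^ 3 / 6 := by
  have hA (u : ℝ) : HasDerivAt (fun u => φ' u - c * u ^ 2 / 2) (φ'' u - c * u) u := by
    refine ((h₂ u).sub (((hasDerivAt_pow 2 u).const_mul c).div_const 2)).congr_deriv ?_
    simp only [Nat.cast_ofNat]
    ring
  have hA_anti : AntitoneOn (fun u => φ' u - c * u ^ 2 / 2) (Set.Ici 0) := by
    refine antitoneOn_of_deriv_nonpos (convex_Ici 0)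
      (fun u _ => (hA u).continuousAt.continuousWithinAt)
      (fun u _ => (hA u).differentiableAt.differentiableWithinAt) fun u hu => ?_
    rw [(hA u).deriv]
    exact sub_nonpos.2 (hbound u (interior_subset hu))
  have hB (u : ℝ) : HasDerivAt (fun u => φ u - φ' 0 * u - c * u ^ 3 / 6)
      (φ' u - φ' 0 - c * u ^ 2 / 2) u := by
    refine (((h₁ u).sub ((hasDerivAt_id u).const_mul (φ' 0))).sub
      (((hasDerivAt_pow 3 u).const_mul c).div_const 6)).congr_deriv ?_
    simp only [Nat.cast_ofNat]
    ring
  have hB_anti : AntitoneOn (fun u => φ u - φ' 0 * u - c * u ^ 3 / 6) (Set.Ici 0) := by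
    refine antitoneOn_of_deriv_nonpos (convex_Ici 0)
      (fun u _ => (hB u).continuousAt.continuousWithinAt)
      (fun u _ => (hB u).differentiableAt.differentiableWithinAt) fun u hu => ?_
    have hu0 : u ∈ Set.Ici (0 : ℝ) := interior_subset hu
    have h := hA_anti Set.self_mem_Ici hu0 hu0
    rw [(hB u).deriv]
    norm_num at h
    linarith
  have h := hB_anti Set.self_mem_Ici ht ht
  norm_num at h
  linarith

theorem ContDiff.differentiable_gradient {F : Type*} [NormedAddCommGroup F]
    [InnerProductSpace ℝ F] [CompleteSpace F] {f : F → ℝ} (hf : ContDiff ℝ 2 f) :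
    Differentiable ℝ (gradient f) :=
  (InnerProductSpace.toDual ℝ F).symm.toContinuousLinearEquiv.differentiable.comp
    ((hf.fderiv_right (m := 1) (by norm_num)).differentiable (by norm_num))

/-- Descent along the negative gradient at a point where the curvature along the gradient is
nonpositive. -/
theorem le_cubic_along_neg_gradient {d : ℕ} {f : EuclideanSpace ℝ (Fin d) → ℝ}
    (hf : ContDiff ℝ 2 f) {L₂ : ℝ} {x : EuclideanSpace ℝ (Fin d)}
    (hsmooth : ∀ t : ℝ, 0 ≤ t →
      ‖hessian f (x - t • gradient f x) - hessian f x‖ ≤ t * L₂ * ‖gradient f x‖)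
    (hNC : ⟪gradient f x, hessian f x (gradient f x)⟫ ≤ 0) {t : ℝ} (ht : 0 ≤ t) :
    f (x - t • gradient f x) ≤
      f x - t * ‖gradient f x‖ ^ 2 + L₂ * ‖gradient f x‖ ^ 3 * t ^ 3 / 6 := by
  set g := gradient f x with hg
  have hline (u : ℝ) : HasDerivAt (fun u : ℝ => x - u • g) (-g) u := by
    simpa using ((hasDerivAt_id u).smul_const g).const_sub x
  have h₁ (u : ℝ) : HasDerivAt (fun u : ℝ => f (x - u • g))
      (-⟪g, gradient f (x - u • g)⟫) u := by
    have h := ((hf.differentiable (by norm_num)) (x - u • g)).hasGradientAt.hasFDerivAt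
    refine (h.comp_hasDerivAt u (hline u)).congr_deriv ?_
    simp
  have h₂ (u : ℝ) : HasDerivAt (fun u : ℝ => -⟪g, gradient f (x - u • g)⟫)
      ⟪g, hessian f (x - u • g) g⟫ u := by
    have h := (hf.differentiable_gradient (x - u • g)).hasFDerivAt
    have h' := h.comp_hasDerivAt u (hline u)
    refine (((hasDerivAt_const u g).inner ℝ h').neg).congr_deriv ?_
    simp [hessian]
  have hbound (u : ℝ) (hu : 0 ≤ u) :
      ⟪g, hessian f (x - u • g) g⟫ ≤ L₂ * ‖g‖ ^ 3 * u := by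
    have hdiff : ⟪g, (hessian f (x - u • g) - hessian f x) g⟫ ≤ L₂ * ‖g‖ ^ 3 * u :=
      calc ⟪g, (hessian f (x - u • g) - hessian f x) g⟫
          ≤ ‖g‖ * ‖(hessian f (x - u • g) - hessian f x) g‖ := real_inner_le_norm _ _
        _ ≤ ‖g‖ * (u * L₂ * ‖g‖ * ‖g‖) := by
          gcongr
          exact ContinuousLinearMap.le_of_opNorm_le _ (hsmooth u hu) g
        _ = L₂ * ‖g‖ ^ 3 * u := by ring
    rw [sub_apply, inner_sub_right] at hdiff
    linarith
  have h := le_cubic_of_second_deriv_le h₁ h₂ hbound ht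
  simp only [zero_smul, sub_zero, ← hg, real_inner_self_eq_norm_sq] at h
  linarith

/-- Per-iteration descent in the negative curvature case. -/
theorem stmt_10 {d : ℕ} (f : EuclideanSpace ℝ (Fin d) → ℝ) (hf : ContDiff ℝ 2 f)
    (L₂ : ℝ) (hL₂ : 0 < L₂)
    (hsmooth : ∀ x : EuclideanSpace ℝ (Fin d), ∀ t : ℝ, 0 ≤ t →
      ‖hessian f (x - t • gradient f x) - hessian f x‖ ≤ t * L₂ * ‖gradient f x‖)
    (ρ sNCmin sNCmax : ℝ) (hρ : ρ ∈ Set.Ioo (0 : ℝ) 1)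
    (hsNCmin : 0 < sNCmin) (hss : sNCmin ≤ sNCmax)
    (x : EuclideanSpace ℝ (Fin d)) (hgx : gradient f x ≠ 0)
    (hNC : ⟪gradient f x, hessian f x (gradient f x)⟫ < 0)
    (s : ℝ) (hs1 : sNCmin ≤ s) (hs2 : s ≤ sNCmax)
    (p : EuclideanSpace ℝ (Fin d)) (hp : p = -(s • gradient f x))
    (α : ℝ) (hα : α = Real.sqrt (6 * (1 - ρ) / (L₂ * sNCmax * ‖p‖))) :
    f (x + α • p) ≤ f x + ρ * α * ⟪p, gradient f x⟫ ∧
      f (x + α • p) ≤ f x -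
        ρ * Real.sqrt (6 * (1 - ρ) * sNCmin / (L₂ * sNCmax)) *
          ‖gradient f x‖ ^ ((3 : ℝ) / 2) := by
  obtain ⟨hρ0, hρ1⟩ := hρ
  have hs : 0 < s := hsNCmin.trans_le hs1
  have hmax : 0 < sNCmax := hs.trans_le hs2
  have hG : 0 < ‖gradient f x‖ := norm_pos_iff.2 hgx
  have hpn : ‖p‖ = s * ‖gradient f x‖ := by
    rw [hp, norm_neg, norm_smul, Real.norm_of_nonneg hs.le]
  have hpi : ⟪p, gradient f x⟫ = -(s * ‖gradient f x‖ ^ 2) := by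
    rw [hp, inner_neg_left, real_inner_smul_left, real_inner_self_eq_norm_sq]
  have hpt : x + α • p = x - (α * s) • gradient f x := by
    rw [hp, smul_neg, smul_smul, sub_eq_add_neg]
  have hα0 : 0 ≤ α := hα ▸ Real.sqrt_nonneg _
  have h1ρ : 0 < 1 - ρ := sub_pos.2 hρ1
  have hdesc := le_cubic_along_neg_gradient hf (hsmooth x) hNC.le (mul_nonneg hα0 hs.le)
  rw [hpn] at hα
  rw [hpi, hpt]
  set G := ‖gradient f x‖
  have hαsq : α ^ 2 = 6 * (1 - ρ) / (L₂ * sNCmax * (s * G)) := by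
    rw [hα, Real.sq_sqrt (by positivity)]
  have hstep : L₂ * G * (α * s) ^ 2 / 6 ≤ 1 - ρ := by
    have h : L₂ * G * (α * s) ^ 2 / 6 = (1 - ρ) * (s / sNCmax) := by
      rw [mul_pow, hαsq]
      field_simp
    rw [h]
    exact mul_le_of_le_one_right h1ρ.le ((div_le_one hmax).2 hs2)
  have harmijo : f (x - (α * s) • gradient f x) ≤ f x + ρ * α * -(s * G ^ 2) := by
    have h := mul_le_mul_of_nonneg_left hstep (by positivity : 0 ≤ α * s * G ^ 2)
    linarith
  refine ⟨harmijo, harmijo.trans ?_⟩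
  have hpow : G ^ ((3 : ℝ) / 2) = Real.sqrt (G ^ 3) := by
    rw [Real.sqrt_eq_rpow, ← Real.rpow_natCast, ← Real.rpow_mul hG.le]
    norm_num
  have hdecrease : Real.sqrt (6 * (1 - ρ) * sNCmin / (L₂ * sNCmax)) * G ^ ((3 : ℝ) / 2) ≤
      α * s * G ^ 2 := by
    rw [hpow, ← Real.sqrt_mul (by positivity)]
    refine Real.sqrt_le_iff.2 ⟨by positivity, ?_⟩
    have h : (α * s * G ^ 2) ^ 2 = 6 * (1 - ρ) * s / (L₂ * sNCmax) * G ^ 3 := by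
      rw [mul_pow, mul_pow, hαsq]
      field_simp
    rw [h]
    gcongr
  linarith [mul_le_mul_of_nonneg_left hdecrease hρ0.le]
end

section
/- (Per-iteration descent, limited positive curvature case.) Let f : ℝ^d → ℝ be twice continuously differentiable and satisfy Hessian directional smoothness with constant L₂ > 0, let ρ ∈ (0, 1/2), σ > 0 and s_LPC_min > 0. Fix x with g(x) ≠ 0, suppose 0 ≤ ⟨g(x), H(x) g(x)⟩ ≤ σ‖g(x)‖², and let p = −s g(x) with s_LPC_min ≤ s ≤ 1/σ. Then the step size α = min{1, √(6σ(1/2 − ρ)/(L₂‖p‖))} satisfies the Armijo condition and yields f(x + α p) ≤ f(x) − ρ · min{ s_LPC_min ‖g(x)‖², √(6σ(1/2 − ρ) s_LPC_min/L₂) · ‖g(x)‖^{3/2} }. -/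
open scoped RealInnerProductSpace

/-- If `a` and `b` are differentiable, `a 0 ≤ b 0` and `a' ≤ b'` on `[0, ∞)`, then `a ≤ b` on
`[0, ∞)`. -/
theorem le_of_hasDerivAt_le {a a' b b' : ℝ → ℝ} (ha : ∀ t, HasDerivAt a (a' t) t)
    (hb : ∀ t, HasDerivAt b (b' t) t) (h0 : a 0 ≤ b 0) (h : ∀ t, 0 ≤ t → a' t ≤ b' t)
    {t : ℝ} (ht : 0 ≤ t) : a t ≤ b t :=
  image_le_of_deriv_right_le_deriv_boundary
    (fun u _ => (ha u).continuousAt.continuousWithinAt)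
    (fun u _ => (ha u).hasDerivWithinAt) h0
    (fun u _ => (hb u).continuousAt.continuousWithinAt)
    (fun u _ => (hb u).hasDerivWithinAt) (fun u hu => h u hu.1) (Set.right_mem_Icc.2 ht)

theorem differentiable_gradient {d : ℕ} {f : EuclideanSpace ℝ (Fin d) → ℝ}
    (hf : ContDiff ℝ 2 f) : Differentiable ℝ (gradient f) := by
  have h : Differentiable ℝ (fderiv ℝ f) :=
    (hf.fderiv_right (m := 1) (by norm_num)).differentiable (by norm_num)
  exact (InnerProductSpace.toDual ℝ
    (EuclideanSpace ℝ (Fin d))).symm.toContinuousLinearEquiv.differentiable.comp h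

/-- Third-order upper bound along the negative gradient ray, under Hessian directional
smoothness at `x`. -/
theorem gradient_step_le {d : ℕ} {f : EuclideanSpace ℝ (Fin d) → ℝ} (hf : ContDiff ℝ 2 f)
    {L : ℝ} {x : EuclideanSpace ℝ (Fin d)}
    (hsmooth : ∀ t : ℝ, 0 ≤ t →
      ‖hessian f (x - t • gradient f x) - hessian f x‖ ≤ t * L * ‖gradient f x‖)
    {t : ℝ} (ht : 0 ≤ t) :
    f (x - t • gradient f x) ≤ f x - t * ‖gradient f x‖ ^ 2
      + t ^ 2 / 2 * ⟪gradient f x, hessian f x (gradient f x)⟫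
      + t ^ 3 / 6 * (L * ‖gradient f x‖ ^ 3) := by
  set g := gradient f x with hg
  set q := ⟪g, hessian f x g⟫ with hq
  have hray (u : ℝ) : HasDerivAt (fun u : ℝ => x - u • g) (-g) u := by
    simpa using ((hasDerivAt_id u).smul_const g).const_sub x
  have hf1 (u : ℝ) : HasDerivAt (fun u : ℝ => f (x - u • g))
      (-⟪gradient f (x - u • g), g⟫) u := by
    have h := ((hf.differentiable (by norm_num)) (x - u • g)).hasGradientAt
    refine (h.hasFDerivAt.comp_hasDerivAt u (hray u)).congr_deriv ?_
    simp
  have hf2 (u : ℝ) : HasDerivAt (fun u : ℝ => -⟪gradient f (x - u • g), g⟫)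
      ⟪g, hessian f (x - u • g) g⟫ u := by
    have h := (differentiable_gradient hf (x - u • g)).hasFDerivAt.comp_hasDerivAt u (hray u)
    refine (h.inner ℝ (hasDerivAt_const u g)).neg.congr_deriv ?_
    simp [hessian, real_inner_comm]
  have hbound (u : ℝ) (hu : 0 ≤ u) :
      ⟪g, hessian f (x - u • g) g⟫ ≤ q + u * (L * ‖g‖ ^ 3) := by
    have h1 : ⟪g, hessian f (x - u • g) g⟫ - q
        = ⟪g, (hessian f (x - u • g) - hessian f x) g⟫ := by
      simp [hq, inner_sub_right]
    have h2 : ⟪g, (hessian f (x - u • g) - hessian f x) g⟫ ≤ ‖g‖ * (u * L * ‖g‖ * ‖g‖) := by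
      refine (real_inner_le_norm _ _).trans ?_
      gcongr
      exact ContinuousLinearMap.le_of_opNorm_le _ (hsmooth u hu) g
    linarith
  have hfirst (u : ℝ) (hu : 0 ≤ u) : -⟪gradient f (x - u • g), g⟫
      ≤ -‖g‖ ^ 2 + u * q + u ^ 2 / 2 * (L * ‖g‖ ^ 3) := by
    refine le_of_hasDerivAt_le (b := fun u => -‖g‖ ^ 2 + u * q + u ^ 2 / 2 * (L * ‖g‖ ^ 3))
      hf2 (fun v => ?_) ?_ hbound hu
    · have h := (((hasDerivAt_id v).mul_const q).const_add (-‖g‖ ^ 2)).add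
        ((((hasDerivAt_id v).pow 2).div_const 2).mul_const (L * ‖g‖ ^ 3))
      exact h.congr_deriv (by simp)
    · simp [← hg]
  refine le_of_hasDerivAt_le
    (b := fun u => f x - u * ‖g‖ ^ 2 + u ^ 2 / 2 * q + u ^ 3 / 6 * (L * ‖g‖ ^ 3))
    hf1 (fun v => ?_) ?_ hfirst ht
  · have h := ((((hasDerivAt_id v).mul_const (‖g‖ ^ 2)).const_sub (f x)).add
      ((((hasDerivAt_id v).pow 2).div_const 2).mul_const q)).add
      ((((hasDerivAt_id v).pow 3).div_const 6).mul_const (L * ‖g‖ ^ 3))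
    refine h.congr_deriv ?_
    simp only [id, Nat.cast_ofNat]
    ring
  · simp

theorem sqrt_div_mul_sq_eq {c L s G : ℝ} (hs : 0 < s) (hG : 0 < G) :
    Real.sqrt (c / (L * (s * G))) * s * G ^ 2
      = Real.sqrt (c * s / L) * G ^ ((3 : ℝ) / 2) := by
  have hpow : G ^ ((3 : ℝ) / 2) = Real.sqrt (G ^ 3) := by
    rw [Real.sqrt_eq_rpow, ← Real.rpow_natCast, ← Real.rpow_mul hG.le]
    norm_num
  have hsq : s * G ^ 2 = Real.sqrt ((s * G ^ 2) ^ 2) := (Real.sqrt_sq (by positivity)).symm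
  rw [hpow, mul_assoc, hsq, ← Real.sqrt_mul' _ (by positivity),
    ← Real.sqrt_mul' _ (by positivity)]
  congr 1
  rcases eq_or_ne L 0 with rfl | hL
  · simp
  · field_simp

/-- Per-iteration descent in the limited positive curvature case. -/
theorem stmt_11 {d : ℕ} (f : EuclideanSpace ℝ (Fin d) → ℝ) (hf : ContDiff ℝ 2 f)
    (L₂ : ℝ) (hL₂ : 0 < L₂)
    (hsmooth : ∀ x : EuclideanSpace ℝ (Fin d), ∀ t : ℝ, 0 ≤ t →
      ‖hessian f (x - t • gradient f x) - hessian f x‖ ≤ t * L₂ * ‖gradient f x‖)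
    (ρ σ sLPCmin : ℝ) (hρ : ρ ∈ Set.Ioo (0 : ℝ) (1 / 2)) (hσ : 0 < σ)
    (hsLPCmin : 0 < sLPCmin)
    (x : EuclideanSpace ℝ (Fin d)) (hgx : gradient f x ≠ 0)
    (hLPC1 : 0 ≤ ⟪gradient f x, hessian f x (gradient f x)⟫)
    (hLPC2 : ⟪gradient f x, hessian f x (gradient f x)⟫ ≤ σ * ‖gradient f x‖ ^ 2)
    (s : ℝ) (hs1 : sLPCmin ≤ s) (hs2 : s ≤ 1 / σ)
    (p : EuclideanSpace ℝ (Fin d)) (hp : p = -(s • gradient f x))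
    (α : ℝ) (hα : α = min 1 (Real.sqrt (6 * σ * (1 / 2 - ρ) / (L₂ * ‖p‖)))) :
    f (x + α • p) ≤ f x + ρ * α * ⟪p, gradient f x⟫ ∧
      f (x + α • p) ≤ f x -
        ρ * min (sLPCmin * ‖gradient f x‖ ^ 2)
          (Real.sqrt (6 * σ * (1 / 2 - ρ) * sLPCmin / L₂) *
            ‖gradient f x‖ ^ ((3 : ℝ) / 2)) := by
  obtain ⟨hρ0, hρ1⟩ := hρ
  have hs : 0 < s := hsLPCmin.trans_le hs1
  have hG : 0 < ‖gradient f x‖ := norm_pos_iff.2 hgx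
  have hsσ : s * σ ≤ 1 := (le_div_iff₀ hσ).1 hs2
  have hpn : ‖p‖ = s * ‖gradient f x‖ := by
    rw [hp, norm_neg, norm_smul, Real.norm_of_nonneg hs.le]
  have hpi : ⟪p, gradient f x⟫ = -(s * ‖gradient f x‖ ^ 2) := by
    rw [hp, inner_neg_left, real_inner_smul_left, real_inner_self_eq_norm_sq]
  have hstep : x + α • p = x - (α * s) • gradient f x := by
    rw [hp, smul_neg, smul_smul, sub_eq_add_neg]
  rw [hpn] at hα
  set G := ‖gradient f x‖
  set c := 6 * σ * (1 / 2 - ρ) with hc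
  have hc0 : 0 < c := by
    have : 0 < 1 / 2 - ρ := by linarith
    positivity
  have hα0 : 0 ≤ α := hα ▸ le_min zero_le_one (Real.sqrt_nonneg _)
  have hα1 : α ≤ 1 := hα ▸ min_le_left _ _
  have hα2 : α ^ 2 * (L₂ * (s * G)) ≤ c := by
    rw [← le_div_iff₀ (by positivity)]
    exact (Real.le_sqrt hα0 (by positivity)).1 (hα ▸ min_le_right _ _)
  have hquad : (α * s) ^ 2 / 2 * ⟪gradient f x, hessian f x (gradient f x)⟫
      ≤ α * s * G ^ 2 / 2 := by
    have h1 : α * (s * σ) ≤ 1 := mul_le_one₀ hα1 (by positivity) hsσ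
    calc (α * s) ^ 2 / 2 * ⟪gradient f x, hessian f x (gradient f x)⟫
        ≤ (α * s) ^ 2 / 2 * (σ * G ^ 2) := by gcongr
      _ = α * s * G ^ 2 / 2 * (α * (s * σ)) := by ring
      _ ≤ α * s * G ^ 2 / 2 := mul_le_of_le_one_right (by positivity) h1
  have hcube : (α * s) ^ 3 / 6 * (L₂ * G ^ 3) ≤ α * s * G ^ 2 * (1 / 2 - ρ) := by
    have h1 : 0 ≤ 1 / 2 - ρ := by linarith
    calc (α * s) ^ 3 / 6 * (L₂ * G ^ 3)
        = α * s * G ^ 2 * s / 6 * (α ^ 2 * (L₂ * (s * G))) := by ring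
      _ ≤ α * s * G ^ 2 * s / 6 * c := by gcongr
      _ = α * s * G ^ 2 * (1 / 2 - ρ) * (s * σ) := by rw [hc]; ring
      _ ≤ α * s * G ^ 2 * (1 / 2 - ρ) := mul_le_of_le_one_right (by positivity) hsσ
  have hdescent : f (x + α • p) ≤ f x - ρ * (α * s * G ^ 2) := by
    have h := gradient_step_le hf (hsmooth x) (mul_nonneg hα0 hs.le)
    rw [hstep]
    linarith
  refine ⟨by rw [hpi]; linarith, hdescent.trans ?_⟩
  gcongr
  rcases min_choice 1 (Real.sqrt (c / (L₂ * (s * G)))) with h | h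
  · rw [hα, h, one_mul]
    exact (min_le_left _ _).trans (by gcongr)
  · rw [hα, h, sqrt_div_mul_sq_eq hs hG]
    exact (min_le_right _ _).trans (by gcongr)
end
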